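/- There exist universal constants c₂ > 0 and c₃ > 0 such that the following holds. Let 0 < ε ≤ 1/10 and δ ≥ ε. Let G* be a set of n points in ℝ^d that is (k,ε,δ)-stable with respect to μ ∈ ℝ^d, let S be an ε-corruption of G*, let G be the set of unchanged indices (|G| ≥ (1−ε)n), and let w* be the uniform weights on G. Define f(w) = ‖Σ_w − I‖_{F,k,k} (computed from S) and let γ = c₃·n^{1/2}·δ²·ε^{−3/2}. If w ∈ Δ_{n,ε} satisfies f((1−η)w + ηw*) ≥ f(w) − γ·η·‖w* − w‖₂ for all η ∈ (0,1) (i.e., w is γ-approximately stationary along the segment toward w*), then ‖μ_w − μ‖_{2,k} ≤ c₂·δ. -/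

import Mathlib

open Finset MeasureTheory

/-- Euclidean (`ℓ₂`) norm of a vector in `ℝ^d`. -/
noncomputable def norm2 {d : ℕ} (x : Fin d → ℝ) : ℝ :=
  Real.sqrt (∑ i, (x i) ^ 2)

/-- The `(2,k)`-norm: max `ℓ₂` norm over `k` entries. -/
noncomputable def norm2k {d : ℕ} (k : ℕ) (x : Fin d → ℝ) : ℝ :=
  sSup {r : ℝ | ∃ S : Finset (Fin d), S.card = k ∧ r = Real.sqrt (∑ i ∈ S, (x i) ^ 2)}

/-- The `(F,k,k)`-norm: `‖A‖_{F,k,k}² = max_{|S|=k} Σ_{i∈S} ‖A_i‖_{2,k}²`. -/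
noncomputable def normFkk {d : ℕ} (k : ℕ) (A : Matrix (Fin d) (Fin d) ℝ) : ℝ :=
  Real.sqrt (sSup {r : ℝ | ∃ S : Finset (Fin d), S.card = k ∧
    r = ∑ i ∈ S, (norm2k k (A i)) ^ 2})

/-- The `(F,m)`-norm: max Frobenius norm over `m` entries of the matrix. -/
noncomputable def normFm {d : ℕ} (m : ℕ) (A : Matrix (Fin d) (Fin d) ℝ) : ℝ :=
  sSup {r : ℝ | ∃ Q : Finset (Fin d × Fin d), Q.card = m ∧
    r = Real.sqrt (∑ p ∈ Q, (A p.1 p.2) ^ 2)}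

/-- Frobenius norm. -/
noncomputable def frobNorm {d : ℕ} (A : Matrix (Fin d) (Fin d) ℝ) : ℝ :=
  Real.sqrt (∑ a, ∑ b, (A a b) ^ 2)

/-- Spectral norm (operator `ℓ₂ → ℓ₂` norm). -/
noncomputable def specNorm {d : ℕ} (A : Matrix (Fin d) (Fin d) ℝ) : ℝ :=
  sSup {r : ℝ | ∃ x : Fin d → ℝ, norm2 x = 1 ∧ r = norm2 (A.mulVec x)}

/-- Quadratic form `vᵀ A v`. -/
noncomputable def quadForm {d : ℕ} (A : Matrix (Fin d) (Fin d) ℝ) (v : Fin d → ℝ) : ℝ :=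
  ∑ a, ∑ b, v a * A a b * v b

/-- Ky Fan 2-norm of a symmetric matrix: max of `|uᵀAu| + |vᵀAv|` over orthonormal pairs. -/
noncomputable def kyFan2 {d : ℕ} (A : Matrix (Fin d) (Fin d) ℝ) : ℝ :=
  sSup {r : ℝ | ∃ u v : Fin d → ℝ, norm2 u = 1 ∧ norm2 v = 1 ∧ (∑ i, u i * v i) = 0 ∧
    r = |quadForm A u| + |quadForm A v|}

/-- `x` has at most `k` nonzero entries. -/
def sparseLE {d : ℕ} (k : ℕ) (x : Fin d → ℝ) : Prop :=
  ∃ S : Finset (Fin d), S.card ≤ k ∧ ∀ i, i ∉ S → x i = 0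

/-- `A_Q`: the matrix equal to `A` on the entry set `Q` and zero elsewhere. -/
def matRestrict {d : ℕ} (A : Matrix (Fin d) (Fin d) ℝ) (Q : Finset (Fin d × Fin d)) :
    Matrix (Fin d) (Fin d) ℝ :=
  Matrix.of fun a b => if (a, b) ∈ Q then A a b else 0

/-- `Δ_{n,ε}`. -/
def Delta (n : ℕ) (ε : ℝ) : Set (Fin n → ℝ) :=
  {w | (∑ i, w i) = 1 ∧ ∀ i, 0 ≤ w i ∧ w i ≤ 1 / ((1 - ε) * n)}

/-- Weighted empirical mean `μ_w`. -/
noncomputable def muW {n d : ℕ} (X : Fin n → Fin d → ℝ) (w : Fin n → ℝ) : Fin d → ℝ :=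
  fun j => ∑ i, w i * X i j

/-- Weighted empirical covariance `Σ_w`. -/
noncomputable def SigmaW {n d : ℕ} (X : Fin n → Fin d → ℝ) (w : Fin n → ℝ) :
    Matrix (Fin d) (Fin d) ℝ :=
  Matrix.of fun a b => ∑ i, w i * (X i a - muW X w a) * (X i b - muW X w b)

/-- Weighted second moment `M_w`. -/
noncomputable def MW {n d : ℕ} (X : Fin n → Fin d → ℝ) (w : Fin n → ℝ) :
    Matrix (Fin d) (Fin d) ℝ :=
  Matrix.of fun a b => ∑ i, w i * X i a * X i b

/-- `(k,ε,δ)`-stability for sparse mean estimation. -/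
def stableMean {n d : ℕ} (k : ℕ) (ε δ : ℝ) (X : Fin n → Fin d → ℝ) (μ : Fin d → ℝ) : Prop :=
  ∀ w ∈ Delta n (2 * ε),
    norm2k k (fun j => muW X w j - μ j) ≤ δ ∧ normFkk k (SigmaW X w - 1) ≤ δ ^ 2 / ε

/-- `(ε,δ)`-spectral stability for (non-sparse) mean estimation. -/
def stableSpec {n d : ℕ} (ε δ : ℝ) (X : Fin n → Fin d → ℝ) (μ : Fin d → ℝ) : Prop :=
  ∀ w ∈ Delta n (2 * ε),
    norm2 (fun j => muW X w j - μ j) ≤ δ ∧ specNorm (SigmaW X w - 1) ≤ δ ^ 2 / ε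

/-- `(k,ε,δ)`-stability for sparse PCA. -/
def stablePCA {n d : ℕ} (k : ℕ) (ε δ ρ : ℝ) (X : Fin n → Fin d → ℝ) (v : Fin d → ℝ) : Prop :=
  ∀ w ∈ Delta n (2 * ε),
    normFm (2 * k ^ 2) (MW X w - (1 + ρ • Matrix.vecMulVec v v)) ≤ δ

/-- `(ε,δ)`-KF2-stability for (non-sparse) PCA. -/
def stableKF2 {n d : ℕ} (ε δ ρ : ℝ) (X : Fin n → Fin d → ℝ) (v : Fin d → ℝ) : Prop :=
  ∀ w ∈ Delta n (2 * ε),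
    kyFan2 (MW X w - (1 + ρ • Matrix.vecMulVec v v)) ≤ δ

/-- `X` is an `ε`-corruption of `Xstar`: they differ in at most `εn` indices. -/
def isCorruption {n d : ℕ} (ε : ℝ) (X Xstar : Fin n → Fin d → ℝ) : Prop :=
  ∃ B : Finset (Fin n), (B.card : ℝ) ≤ ε * n ∧ ∀ i, i ∉ B → X i = Xstar i

/-- Uniform weight vector on a finite index set `G`. -/
noncomputable def uniformOn {n : ℕ} (G : Finset (Fin n)) : Fin n → ℝ :=
  fun i => if i ∈ G then ((G.card : ℝ))⁻¹ else 0

section SparseNorms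

theorem abs_sum_mul_le_sqrt_mul_sqrt {ι : Type*} (S : Finset ι) (x y : ι → ℝ) :
    |∑ i ∈ S, x i * y i| ≤ Real.sqrt (∑ i ∈ S, x i ^ 2) * Real.sqrt (∑ i ∈ S, y i ^ 2) := by
  rw [← Real.sqrt_mul (Finset.sum_nonneg fun i _ => sq_nonneg (x i))]
  exact Real.abs_le_sqrt (Finset.sum_mul_sq_le_sq_mul_sq S x y)

theorem sqrt_sum_add_sq_le {ι : Type*} (S : Finset ι) (x y : ι → ℝ) :
    Real.sqrt (∑ i ∈ S, (x i + y i) ^ 2)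
      ≤ Real.sqrt (∑ i ∈ S, x i ^ 2) + Real.sqrt (∑ i ∈ S, y i ^ 2) := by
  have h := (abs_le.1 (abs_sum_mul_le_sqrt_mul_sqrt S x y)).2
  have hx := Real.sq_sqrt (Finset.sum_nonneg fun i (_ : i ∈ S) => sq_nonneg (x i))
  have hy := Real.sq_sqrt (Finset.sum_nonneg fun i (_ : i ∈ S) => sq_nonneg (y i))
  have he : ∑ i ∈ S, (x i + y i) ^ 2
      = ∑ i ∈ S, x i ^ 2 + 2 * ∑ i ∈ S, x i * y i + ∑ i ∈ S, y i ^ 2 := by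
    rw [Finset.mul_sum, ← Finset.sum_add_distrib, ← Finset.sum_add_distrib]
    exact Finset.sum_congr rfl fun i _ => by ring
  apply Real.sqrt_le_iff.2 ⟨by positivity, ?_⟩
  rw [he]
  nlinarith

variable {d k : ℕ}

theorem norm2k_nonneg (x : Fin d → ℝ) : 0 ≤ norm2k k x := by
  apply Real.sSup_nonneg
  rintro r ⟨S, -, rfl⟩
  positivity

theorem norm2k_le {x : Fin d → ℝ} {r : ℝ} (hr : 0 ≤ r)
    (h : ∀ S : Finset (Fin d), S.card = k → Real.sqrt (∑ i ∈ S, x i ^ 2) ≤ r) :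
    norm2k k x ≤ r := by
  apply Real.sSup_le _ hr
  rintro _ ⟨S, hS, rfl⟩
  exact h S hS

theorem le_norm2k {S : Finset (Fin d)} (hS : S.card = k) (x : Fin d → ℝ) :
    Real.sqrt (∑ i ∈ S, x i ^ 2) ≤ norm2k k x := by
  refine le_csSup ?_ ⟨S, hS, rfl⟩
  refine ⟨Real.sqrt (∑ i, x i ^ 2), ?_⟩
  rintro _ ⟨T, -, rfl⟩
  exact Real.sqrt_le_sqrt (Finset.sum_le_sum_of_subset_of_nonneg (Finset.subset_univ T)
    fun i _ _ => sq_nonneg _)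

theorem sum_sq_le_norm2k_sq {S : Finset (Fin d)} (hS : S.card = k) (x : Fin d → ℝ) :
    ∑ i ∈ S, x i ^ 2 ≤ norm2k k x ^ 2 :=
  (Real.sqrt_le_left (norm2k_nonneg x)).1 (le_norm2k hS x)

theorem norm2k_add_le (x y : Fin d → ℝ) :
    norm2k k (fun i => x i + y i) ≤ norm2k k x + norm2k k y :=
  norm2k_le (add_nonneg (norm2k_nonneg x) (norm2k_nonneg y)) fun S hS =>
    (sqrt_sum_add_sq_le S x y).trans (add_le_add (le_norm2k hS x) (le_norm2k hS y))

theorem norm2k_const_mul_le (c : ℝ) (x : Fin d → ℝ) :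
    norm2k k (fun i => c * x i) ≤ |c| * norm2k k x := by
  apply norm2k_le (mul_nonneg (abs_nonneg c) (norm2k_nonneg x))
  intro S hS
  have : ∑ i ∈ S, (c * x i) ^ 2 = c ^ 2 * ∑ i ∈ S, x i ^ 2 := by
    rw [Finset.mul_sum]
    exact Finset.sum_congr rfl fun i _ => by ring
  rw [this, Real.sqrt_mul (sq_nonneg c), Real.sqrt_sq_eq_abs]
  exact mul_le_mul_of_nonneg_left (le_norm2k hS x) (abs_nonneg c)

theorem norm2k_sub_comm (x y : Fin d → ℝ) :
    norm2k k (fun i => x i - y i) = norm2k k (fun i => y i - x i) := by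
  simp only [norm2k, sub_sq_comm]

theorem norm2k_sub_le (x y z : Fin d → ℝ) :
    norm2k k (fun i => x i - z i)
      ≤ norm2k k (fun i => x i - y i) + norm2k k (fun i => y i - z i) := by
  simpa using norm2k_add_le (k := k) (fun i => x i - y i) (fun i => y i - z i)

theorem normFkk_nonneg (A : Matrix (Fin d) (Fin d) ℝ) : 0 ≤ normFkk k A := Real.sqrt_nonneg _

theorem normFkk_le {A : Matrix (Fin d) (Fin d) ℝ} {r : ℝ} (hr : 0 ≤ r)
    (h : ∀ S : Finset (Fin d), S.card = k → Real.sqrt (∑ i ∈ S, norm2k k (A i) ^ 2) ≤ r) :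
    normFkk k A ≤ r := by
  apply (Real.sqrt_le_left hr).2
  apply Real.sSup_le _ (sq_nonneg r)
  rintro _ ⟨S, hS, rfl⟩
  exact (Real.sqrt_le_left hr).1 (h S hS)

theorem le_normFkk {S : Finset (Fin d)} (hS : S.card = k) (A : Matrix (Fin d) (Fin d) ℝ) :
    Real.sqrt (∑ i ∈ S, norm2k k (A i) ^ 2) ≤ normFkk k A := by
  apply Real.sqrt_le_sqrt
  refine le_csSup ?_ ⟨S, hS, rfl⟩
  refine ⟨∑ i, norm2k k (A i) ^ 2, ?_⟩
  rintro _ ⟨T, -, rfl⟩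
  exact Finset.sum_le_sum_of_subset_of_nonneg (Finset.subset_univ T) fun i _ _ => sq_nonneg _

theorem normFkk_add_le (A B : Matrix (Fin d) (Fin d) ℝ) :
    normFkk k (A + B) ≤ normFkk k A + normFkk k B := by
  apply normFkk_le (add_nonneg (normFkk_nonneg A) (normFkk_nonneg B))
  intro S hS
  calc Real.sqrt (∑ i ∈ S, norm2k k ((A + B) i) ^ 2)
      ≤ Real.sqrt (∑ i ∈ S, (norm2k k (A i) + norm2k k (B i)) ^ 2) := by
        gcongr with i
        · exact norm2k_nonneg _
        · exact norm2k_add_le (A i) (B i)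
    _ ≤ _ := sqrt_sum_add_sq_le S _ _
    _ ≤ _ := add_le_add (le_normFkk hS A) (le_normFkk hS B)

theorem normFkk_smul_le {c : ℝ} (hc : 0 ≤ c) (A : Matrix (Fin d) (Fin d) ℝ) :
    normFkk k (c • A) ≤ c * normFkk k A := by
  apply normFkk_le (mul_nonneg hc (normFkk_nonneg A))
  intro S hS
  calc Real.sqrt (∑ i ∈ S, norm2k k ((c • A) i) ^ 2)
      ≤ Real.sqrt (∑ i ∈ S, (c * norm2k k (A i)) ^ 2) := by
        gcongr with i
        · exact norm2k_nonneg _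
        · exact (norm2k_const_mul_le c (A i)).trans_eq (by rw [abs_of_nonneg hc])
    _ = c * Real.sqrt (∑ i ∈ S, norm2k k (A i) ^ 2) := by
        simp_rw [mul_pow]
        rw [← Finset.mul_sum, Real.sqrt_mul (sq_nonneg c), Real.sqrt_sq hc]
    _ ≤ _ := mul_le_mul_of_nonneg_left (le_normFkk hS A) hc

theorem normFkk_vecMulVec_self_le (u : Fin d → ℝ) :
    normFkk k (Matrix.vecMulVec u u) ≤ norm2k k u ^ 2 := by
  apply normFkk_le (sq_nonneg _)
  intro S hS
  apply (Real.sqrt_le_left (sq_nonneg _)).2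
  calc ∑ i ∈ S, norm2k k (Matrix.vecMulVec u u i) ^ 2
      ≤ ∑ i ∈ S, (|u i| * norm2k k u) ^ 2 := by
        gcongr with i
        · exact norm2k_nonneg _
        · exact norm2k_const_mul_le (u i) u
    _ = (∑ i ∈ S, u i ^ 2) * norm2k k u ^ 2 := by
        simp_rw [mul_pow, sq_abs]
        rw [Finset.sum_mul]
    _ ≤ norm2k k u ^ 2 * norm2k k u ^ 2 := by
        gcongr
        exact sum_sq_le_norm2k_sq hS u
    _ = _ := by ring

theorem abs_sum_quad_le_normFkk {S : Finset (Fin d)} (hS : S.card = k)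
    (A : Matrix (Fin d) (Fin d) ℝ) (v : Fin d → ℝ) :
    |∑ a ∈ S, ∑ b ∈ S, v a * A a b * v b| ≤ (∑ a ∈ S, v a ^ 2) * normFkk k A := by
  have hv := Real.mul_self_sqrt (Finset.sum_nonneg fun i (_ : i ∈ S) => sq_nonneg (v i))
  set s := Real.sqrt (∑ a ∈ S, v a ^ 2) with hs
  calc |∑ a ∈ S, ∑ b ∈ S, v a * A a b * v b|
      ≤ ∑ a ∈ S, |v a| * (norm2k k (A a) * s) := by
        apply (Finset.abs_sum_le_sum_abs _ _).trans
        apply Finset.sum_le_sum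
        intro a _
        simp_rw [mul_assoc]
        rw [← Finset.mul_sum, abs_mul]
        refine mul_le_mul_of_nonneg_left ?_ (abs_nonneg _)
        exact (abs_sum_mul_le_sqrt_mul_sqrt S (A a) v).trans
          (mul_le_mul_of_nonneg_right (le_norm2k hS (A a)) (Real.sqrt_nonneg _))
    _ = s * ∑ a ∈ S, |v a| * norm2k k (A a) := by
        rw [Finset.mul_sum]
        exact Finset.sum_congr rfl fun i _ => by ring
    _ ≤ s * (s * normFkk k A) := by
        have h := (abs_le.1 (abs_sum_mul_le_sqrt_mul_sqrt S (fun a => |v a|)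
          (fun a => norm2k k (A a)))).2
        simp only [sq_abs] at h
        gcongr
        exact h.trans (mul_le_mul_of_nonneg_left (le_normFkk hS A) (Real.sqrt_nonneg _))
    _ = _ := by rw [← mul_assoc, hv]

end SparseNorms

section WeightedMoments

variable {n d k : ℕ}

theorem SigmaW_apply_of_sum_eq_one (X : Fin n → Fin d → ℝ) {w : Fin n → ℝ}
    (hw : ∑ i, w i = 1) (a b : Fin d) :
    SigmaW X w a b = ∑ i, w i * X i a * X i b - muW X w a * muW X w b := by
  have : ∀ i, w i * (X i a - muW X w a) * (X i b - muW X w b)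
      = w i * X i a * X i b - (w i * X i a) * muW X w b - (w i * X i b) * muW X w a
        + w i * (muW X w a * muW X w b) := fun i => by ring
  simp only [SigmaW, Matrix.of_apply, this, Finset.sum_add_distrib, Finset.sum_sub_distrib,
    ← Finset.sum_mul, hw]
  simp only [muW]
  ring

theorem SigmaW_segment (X : Fin n → Fin d → ℝ) {w p : Fin n → ℝ}
    (hw : ∑ i, w i = 1) (hp : ∑ i, p i = 1) (η : ℝ) :
    SigmaW X (fun i => (1 - η) * w i + η * p i) - 1
      = (1 - η) • (SigmaW X w - 1) + η • (SigmaW X p - 1)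
        + (η * (1 - η)) • Matrix.vecMulVec (fun j => muW X w j - muW X p j)
            (fun j => muW X w j - muW X p j) := by
  have hs : ∑ i, ((1 - η) * w i + η * p i) = 1 := by
    rw [Finset.sum_add_distrib, ← Finset.mul_sum, ← Finset.mul_sum, hw, hp]
    ring
  have hμ : ∀ j, muW X (fun i => (1 - η) * w i + η * p i) j
      = (1 - η) * muW X w j + η * muW X p j := by
    intro j
    simp only [muW, Finset.mul_sum, ← Finset.sum_add_distrib]
    exact Finset.sum_congr rfl fun i _ => by ring
  ext a b
  have hM : ∑ i, ((1 - η) * w i + η * p i) * X i a * X i b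
      = (1 - η) * ∑ i, w i * X i a * X i b + η * ∑ i, p i * X i a * X i b := by
    simp only [Finset.mul_sum, ← Finset.sum_add_distrib]
    exact Finset.sum_congr rfl fun i _ => by ring
  simp only [Matrix.sub_apply, Matrix.add_apply, Matrix.smul_apply, smul_eq_mul,
    Matrix.vecMulVec_apply, SigmaW_apply_of_sum_eq_one X hs, SigmaW_apply_of_sum_eq_one X hw,
    SigmaW_apply_of_sum_eq_one X hp, hμ, hM]
  ring

theorem normFkk_segment_le (X : Fin n → Fin d → ℝ) {w p : Fin n → ℝ}
    (hw : ∑ i, w i = 1) (hp : ∑ i, p i = 1) {η : ℝ} (h0 : 0 ≤ η) (h1 : η ≤ 1) :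
    normFkk k (SigmaW X (fun i => (1 - η) * w i + η * p i) - 1)
      ≤ (1 - η) * normFkk k (SigmaW X w - 1) + η * normFkk k (SigmaW X p - 1)
        + η * (1 - η) * norm2k k (fun j => muW X w j - muW X p j) ^ 2 := by
  have h2 : 0 ≤ 1 - η := by linarith
  rw [SigmaW_segment X hw hp]
  refine (normFkk_add_le _ _).trans (add_le_add ((normFkk_add_le _ _).trans
    (add_le_add (normFkk_smul_le h2 _) (normFkk_smul_le h0 _))) ?_)
  exact (normFkk_smul_le (mul_nonneg h0 h2) _).trans
    (mul_le_mul_of_nonneg_left (normFkk_vecMulVec_self_le _) (mul_nonneg h0 h2))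

theorem muW_congr {X Y : Fin n → Fin d → ℝ} {p : Fin n → ℝ}
    (h : ∀ i, p i = 0 ∨ X i = Y i) : muW X p = muW Y p := by
  ext j
  refine Finset.sum_congr rfl fun i _ => ?_
  rcases h i with h | h <;> simp [h]

theorem SigmaW_congr {X Y : Fin n → Fin d → ℝ} {p : Fin n → ℝ}
    (h : ∀ i, p i = 0 ∨ X i = Y i) : SigmaW X p = SigmaW Y p := by
  ext a b
  simp only [SigmaW, Matrix.of_apply, muW_congr h]
  refine Finset.sum_congr rfl fun i _ => ?_
  rcases h i with h | h <;> simp [h]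

theorem sum_quad_SigmaW (X : Fin n → Fin d → ℝ) (w : Fin n → ℝ) (S : Finset (Fin d))
    (v : Fin d → ℝ) :
    ∑ a ∈ S, ∑ b ∈ S, v a * SigmaW X w a b * v b
      = ∑ i, w i * (∑ a ∈ S, v a * X i a - ∑ a ∈ S, v a * muW X w a) ^ 2 := by
  simp only [← Finset.sum_sub_distrib, ← mul_sub, sq, Finset.sum_mul_sum]
  simp only [SigmaW, Matrix.of_apply, Finset.mul_sum, Finset.sum_mul]
  rw [Finset.sum_comm' (t' := S) (s' := fun _ => S) (by simp)]
  conv_rhs => rw [Finset.sum_comm]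
  rw [Finset.sum_comm]
  refine Finset.sum_congr rfl fun a _ => ?_
  conv_rhs => rw [Finset.sum_comm]
  refine Finset.sum_congr rfl fun b _ => ?_
  exact Finset.sum_congr rfl fun i _ => by ring

theorem sum_quad_sub_one (A : Matrix (Fin d) (Fin d) ℝ) (S : Finset (Fin d)) (v : Fin d → ℝ) :
    ∑ a ∈ S, ∑ b ∈ S, v a * (A - 1) a b * v b
      = ∑ a ∈ S, ∑ b ∈ S, v a * A a b * v b - ∑ a ∈ S, v a ^ 2 := by
  rw [← Finset.sum_sub_distrib]
  refine Finset.sum_congr rfl fun a ha => ?_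
  simp only [Matrix.sub_apply, mul_sub, sub_mul, Finset.sum_sub_distrib, Matrix.one_apply]
  simp [ha, sq]

theorem sum_mul_muW (X : Fin n → Fin d → ℝ) (w : Fin n → ℝ) (S : Finset (Fin d))
    (v : Fin d → ℝ) : ∑ a ∈ S, v a * muW X w a = ∑ i, w i * ∑ a ∈ S, v a * X i a := by
  simp only [muW, Finset.mul_sum]
  rw [Finset.sum_comm]
  exact Finset.sum_congr rfl fun a _ => Finset.sum_congr rfl fun i _ => by ring

theorem variance_ge_of_split (G : Finset (Fin n)) {w : Fin n → ℝ} (z : Fin n → ℝ) {m c W β : ℝ}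
    (h0 : ∀ i, 0 ≤ w i) (h1 : ∑ i, w i = 1) (hm : m = ∑ i, w i * z i) (hW : W = ∑ i ∈ G, w i)
    (hc : W * c = ∑ i ∈ G, w i * z i) (hβ : 1 - W ≤ β) :
    β * ∑ i ∈ G, w i * (z i - c) ^ 2 + (W * (c - m)) ^ 2 ≤ β * ∑ i, w i * (z i - m) ^ 2 := by
  have hWs : W + ∑ i ∈ Gᶜ, w i = 1 := by rw [hW, Finset.sum_add_sum_compl, h1]
  have hBnn : 0 ≤ ∑ i ∈ Gᶜ, w i := Finset.sum_nonneg fun i _ => h0 i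
  have hWnn : 0 ≤ W := hW ▸ Finset.sum_nonneg fun i _ => h0 i
  have hβ0 : 0 ≤ β := by linarith
  have hG : ∑ i ∈ G, w i * (z i - m) ^ 2
      = ∑ i ∈ G, w i * (z i - c) ^ 2 + W * (c - m) ^ 2 := by
    have : ∀ i, w i * (z i - m) ^ 2 = w i * (z i - c) ^ 2 + 2 * (c - m) * (w i * z i)
        - w i * (2 * (c - m) * c) + w i * (c - m) ^ 2 := fun i => by ring
    simp only [this, Finset.sum_add_distrib, Finset.sum_sub_distrib, ← Finset.mul_sum,
      ← Finset.sum_mul, ← hc, ← hW]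
    ring
  have hB : (W * (c - m)) ^ 2 ≤ β * ∑ i ∈ Gᶜ, w i * (z i - m) ^ 2 := by
    have hsum : ∑ i ∈ Gᶜ, w i * (z i - m) = -(W * (c - m)) := by
      have e1 : ∑ i ∈ G, w i * (z i - m) + ∑ i ∈ Gᶜ, w i * (z i - m) = 0 := by
        rw [Finset.sum_add_sum_compl]
        simp only [mul_sub, Finset.sum_sub_distrib, ← Finset.sum_mul, h1, ← hm]
        ring
      have e2 : ∑ i ∈ G, w i * (z i - m) = W * (c - m) := by
        simp only [mul_sub, Finset.sum_sub_distrib, ← Finset.sum_mul, ← hc, ← hW]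
      linarith
    have hcs := Finset.sum_sq_le_sum_mul_sum_of_sq_le_mul Gᶜ (r := fun i => w i * (z i - m))
      (f := w) (g := fun i => w i * (z i - m) ^ 2) (fun i _ => h0 i)
      (fun i _ => mul_nonneg (h0 i) (sq_nonneg _)) (fun i _ => by apply le_of_eq; ring)
    rw [hsum, neg_sq] at hcs
    exact hcs.trans (mul_le_mul_of_nonneg_right (by linarith)
      (Finset.sum_nonneg fun i _ => mul_nonneg (h0 i) (sq_nonneg _)))
  rw [← Finset.sum_add_sum_compl G fun i => w i * (z i - m) ^ 2, hG, mul_add, mul_add]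
  have : 0 ≤ β * (W * (c - m) ^ 2) := by positivity
  linarith

/-- The weights `w` conditioned on `G`. -/
noncomputable def condWeights (G : Finset (Fin n)) (w : Fin n → ℝ) : Fin n → ℝ :=
  fun i => if i ∈ G then w i / ∑ j ∈ G, w j else 0

theorem sum_condWeights_mul (G : Finset (Fin n)) {w : Fin n → ℝ} (hW : ∑ j ∈ G, w j ≠ 0)
    (z : Fin n → ℝ) :
    (∑ j ∈ G, w j) * ∑ i, condWeights G w i * z i = ∑ i ∈ G, w i * z i := by
  simp only [condWeights, ite_mul, zero_mul, Finset.sum_ite_mem, Finset.univ_inter]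
  rw [Finset.mul_sum]
  refine Finset.sum_congr rfl fun i _ => ?_
  field_simp

/-- A mean shift `v` caused by the weight `w` puts outside `G` inflates the covariance. -/
theorem sum_sq_mean_shift_le (X : Fin n → Fin d → ℝ) (G : Finset (Fin n)) {w : Fin n → ℝ}
    (h0 : ∀ i, 0 ≤ w i) (h1 : ∑ i, w i = 1) {β : ℝ} (hβ : 1 - ∑ i ∈ G, w i ≤ β)
    (hW : 0 < ∑ i ∈ G, w i) {S : Finset (Fin d)} (hS : S.card = k) :
    (∑ i ∈ G, w i) ^ 2 * ∑ a ∈ S, (muW X w a - muW X (condWeights G w) a) ^ 2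
      ≤ β * (normFkk k (SigmaW X w - 1) + normFkk k (SigmaW X (condWeights G w) - 1) + β) := by
  set W := ∑ i ∈ G, w i with hWdef
  set p := condWeights G w with hp
  set v : Fin d → ℝ := fun a => muW X w a - muW X p a with hv
  set F := normFkk k (SigmaW X w - 1) with hF
  set K := normFkk k (SigmaW X p - 1) with hK
  have hF0 : 0 ≤ F := normFkk_nonneg _
  have hK0 : 0 ≤ K := normFkk_nonneg _
  have hW1 : W ≤ 1 := by
    rw [← h1]
    exact Finset.sum_le_sum_of_subset_of_nonneg (Finset.subset_univ G) fun i _ _ => h0 i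
  have hβ0 : 0 ≤ β := by linarith
  change W ^ 2 * ∑ a ∈ S, v a ^ 2 ≤ _
  set s := ∑ a ∈ S, v a ^ 2 with hs
  rcases (Finset.sum_nonneg fun a (_ : a ∈ S) => sq_nonneg (v a)).eq_or_lt with hs0 | hs0
  · rw [hs, ← hs0, mul_zero]
    positivity
  have hqw := (abs_le.1 (abs_sum_quad_le_normFkk hS (SigmaW X w - 1) v)).2
  have hqp := (abs_le.1 (abs_sum_quad_le_normFkk hS (SigmaW X p - 1) v)).1
  rw [sum_quad_sub_one, sum_quad_SigmaW] at hqw hqp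
  set z : Fin n → ℝ := fun i => ∑ a ∈ S, v a * X i a with hz
  set m := ∑ a ∈ S, v a * muW X w a with hm
  set c := ∑ a ∈ S, v a * muW X p a with hc
  have hmain := variance_ge_of_split G z (m := m) (c := c) h0 h1 (sum_mul_muW X w S v) hWdef
    (by rw [hc, sum_mul_muW, hp, sum_condWeights_mul G hW.ne']) hβ
  rw [← sum_condWeights_mul G hW.ne' fun i => (z i - c) ^ 2] at hmain
  have hcm : c - m = -s := by
    rw [hc, hm, hs, ← Finset.sum_sub_distrib, ← Finset.sum_neg_distrib]
    exact Finset.sum_congr rfl fun a _ => by simp only [hv]; ring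
  rw [hcm] at hmain
  change ∑ i, w i * (z i - m) ^ 2 - s ≤ s * F at hqw
  change -(s * K) ≤ ∑ i, p i * (z i - c) ^ 2 - s at hqp
  have e1 : β * ∑ i, w i * (z i - m) ^ 2 ≤ β * (s + s * F) :=
    mul_le_mul_of_nonneg_left (by linarith) hβ0
  have e2 : β * (W * (s - s * K)) ≤ β * (W * ∑ i, p i * (z i - c) ^ 2) :=
    mul_le_mul_of_nonneg_left (mul_le_mul_of_nonneg_left (by linarith) hW.le) hβ0
  have e3 : s * (W ^ 2 * s) ≤ s * (β * (1 + F - W + W * K)) := by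
    change β * (W * ∑ i, p i * (z i - c) ^ 2) + _ ≤ _ at hmain
    nlinarith
  refine (le_of_mul_le_mul_left e3 hs0).trans (mul_le_mul_of_nonneg_left ?_ hβ0)
  nlinarith

theorem one_sub_mul_natCast_pos {ε : ℝ} (hε : ε < 1) {w : Fin n → ℝ} (hw : ∑ i, w i = 1) :
    0 < (1 - ε) * (n : ℝ) := by
  have : n ≠ 0 := by
    rintro rfl
    simp at hw
  have : (0 : ℝ) < n := by positivity
  exact mul_pos (by linarith) this

theorem Delta_subset_two_mul {ε : ℝ} (h0 : 0 ≤ ε) (h1 : 2 * ε < 1) :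
    Delta n ε ⊆ Delta n (2 * ε) := by
  rintro w ⟨hw, hb⟩
  have := one_sub_mul_natCast_pos h1 hw
  refine ⟨hw, fun i => ⟨(hb i).1, (hb i).2.trans ?_⟩⟩
  gcongr
  linarith

theorem uniformOn_mem_Delta {ε : ℝ} {G : Finset (Fin n)} (hn : 0 < (1 - ε) * (n : ℝ))
    (hG : (1 - ε) * n ≤ (G.card : ℝ)) : uniformOn G ∈ Delta n ε := by
  have hc : (0 : ℝ) < G.card := hn.trans_le hG
  refine ⟨?_, fun i => ?_⟩
  · simp only [uniformOn, Finset.sum_ite_mem, Finset.univ_inter, Finset.sum_const, nsmul_eq_mul]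
    exact mul_inv_cancel₀ hc.ne'
  · simp only [uniformOn]
    split_ifs
    · refine ⟨by positivity, ?_⟩
      rw [← one_div]
      gcongr
    · exact ⟨le_rfl, by positivity⟩

theorem one_sub_sum_le_of_mem_Delta {ε : ℝ} (hε : ε < 1) {G : Finset (Fin n)} {w : Fin n → ℝ}
    (hw : w ∈ Delta n ε) (hG : (1 - ε) * n ≤ (G.card : ℝ)) :
    1 - ∑ i ∈ G, w i ≤ ε / (1 - ε) := by
  obtain ⟨h1, hb⟩ := hw
  have hn := one_sub_mul_natCast_pos hε h1
  have hn' : (0 : ℝ) < n := pos_of_mul_pos_right hn (by linarith)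
  have hε' : 0 < 1 - ε := by linarith
  have hsplit : ∑ i ∈ G, w i + ∑ i ∈ Gᶜ, w i = 1 := by rw [Finset.sum_add_sum_compl, h1]
  have hcard : (G.card : ℝ) + (Gᶜ).card = n := by
    exact_mod_cast (Finset.card_add_card_compl G).trans (Fintype.card_fin n)
  have : ∑ i ∈ Gᶜ, w i ≤ (Gᶜ).card • (1 / ((1 - ε) * n)) :=
    Finset.sum_le_card_nsmul _ _ _ fun i _ => (hb i).2
  rw [nsmul_eq_mul] at this
  have h2 : ((Gᶜ).card : ℝ) * (1 / ((1 - ε) * n)) ≤ (ε * n) * (1 / ((1 - ε) * n)) := by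
    gcongr
    linarith
  have h3 : (ε * n) * (1 / ((1 - ε) * n)) = ε / (1 - ε) := by field_simp
  linarith

theorem condWeights_mem_Delta {ε : ℝ} (hε : 2 * ε < 1) {G : Finset (Fin n)}
    {w : Fin n → ℝ} (hw : w ∈ Delta n ε) (hG : (1 - ε) * n ≤ (G.card : ℝ)) :
    condWeights G w ∈ Delta n (2 * ε) := by
  have h := one_sub_sum_le_of_mem_Delta (by linarith) hw hG
  obtain ⟨h1, hb⟩ := hw
  have hε' : 0 < 1 - ε := by linarith
  have hε2 : 0 < 1 - 2 * ε := by linarith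
  have hn := one_sub_mul_natCast_pos (by linarith : ε < 1) h1
  have hn' : (0 : ℝ) < n := pos_of_mul_pos_right hn (by linarith)
  have hW : (1 - 2 * ε) / (1 - ε) ≤ ∑ i ∈ G, w i := by
    have : (1 - 2 * ε) / (1 - ε) = 1 - ε / (1 - ε) := by field_simp; ring
    linarith
  have hW0 : 0 < ∑ i ∈ G, w i := (div_pos hε2 hε').trans_le hW
  refine ⟨?_, fun i => ?_⟩
  · have := sum_condWeights_mul G hW0.ne' fun _ => 1
    simp only [mul_one] at this
    exact (mul_eq_left₀ hW0.ne').1 this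
  · simp only [condWeights]
    split_ifs
    · refine ⟨div_nonneg (hb i).1 hW0.le, ?_⟩
      rw [div_le_iff₀ hW0]
      refine (hb i).2.trans ?_
      have : 1 / ((1 - ε) * n) = 1 / ((1 - 2 * ε) * n) * ((1 - 2 * ε) / (1 - ε)) := by
        rw [div_mul_div_comm, one_mul, mul_assoc, mul_comm (n : ℝ),
          div_mul_cancel_left₀ hε2.ne', one_div]
      rw [this]
      gcongr
    · exact ⟨le_rfl, by positivity⟩

theorem sum_sub_sq_le_of_mem_Delta {ε : ℝ} (hε : ε < 1) {w p : Fin n → ℝ} (hw : w ∈ Delta n ε)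
    (hp : p ∈ Delta n ε) :
    ∑ i, (p i - w i) ^ 2 ≤ 2 * ε / ((1 - ε) ^ 2 * n) := by
  obtain ⟨hw1, hw⟩ := hw
  obtain ⟨hp1, hp⟩ := hp
  have hn := one_sub_mul_natCast_pos hε hw1
  have hn' : (0 : ℝ) < n := pos_of_mul_pos_right hn (by linarith)
  have hε' : 0 < 1 - ε := by linarith
  set U := 1 / ((1 - ε) * n) with hU
  calc ∑ i, (p i - w i) ^ 2 ≤ ∑ i, U * (2 * (U - p i) - (w i - p i)) := by
        refine Finset.sum_le_sum fun i _ => ?_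
        have ⟨a1, a2⟩ := hw i
        have ⟨b1, b2⟩ := hp i
        rcases le_total (p i) (w i) with h | h <;> nlinarith
    _ = 2 * U * (n * U - 1) := by
        simp only [← Finset.mul_sum, Finset.sum_sub_distrib, hw1, hp1, Finset.sum_const,
          Finset.card_univ, Fintype.card_fin, nsmul_eq_mul]
        ring
    _ = _ := by
        rw [hU]
        field_simp
        ring

theorem slack_mul_norm2_le {ε δ : ℝ} (hε0 : 0 < ε) (hε : ε ≤ 1 / 10) {w p : Fin n → ℝ}
    (hw : w ∈ Delta n ε) (hp : p ∈ Delta n ε) :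
    Real.sqrt n * δ ^ 2 / Real.sqrt (ε ^ 3) * norm2 (fun i => p i - w i) ≤ 2 * (δ ^ 2 / ε) := by
  have hn := one_sub_mul_natCast_pos (by linarith : ε < 1) hw.1
  have hn' : (0 : ℝ) < n := pos_of_mul_pos_right hn (by linarith)
  have h : norm2 (fun i => p i - w i) ≤ 2 * Real.sqrt (ε / n) := by
    have : 2 * Real.sqrt (ε / n) = Real.sqrt (4 * (ε / n)) := by
      rw [Real.sqrt_mul (by norm_num), show (4 : ℝ) = 2 ^ 2 by norm_num,
        Real.sqrt_sq (by norm_num)]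
    rw [this]
    apply Real.sqrt_le_sqrt
    refine (sum_sub_sq_le_of_mem_Delta (by linarith) hw hp).trans ?_
    have hε' : 0 < 1 - ε := by linarith
    rw [← mul_div_assoc, div_le_div_iff₀ (by positivity) hn']
    have : 2 ≤ 4 * (1 - ε) ^ 2 := by nlinarith
    have := mul_le_mul_of_nonneg_right this (by positivity : 0 ≤ ε * n)
    linarith
  have hc : Real.sqrt (ε ^ 3) = ε * Real.sqrt ε := by
    rw [show ε ^ 3 = ε ^ 2 * ε by ring, Real.sqrt_mul (sq_nonneg _), Real.sqrt_sq hε0.le]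
  calc _ ≤ Real.sqrt n * δ ^ 2 / Real.sqrt (ε ^ 3) * (2 * Real.sqrt (ε / n)) := by gcongr
    _ = _ := by
      have := Real.sqrt_pos.2 hε0
      have := Real.sqrt_pos.2 hn'
      rw [hc, Real.sqrt_div hε0.le]
      field_simp

end WeightedMoments

/-- any `γ`-approximately stationary point (along the segment toward
the uniform weights on good samples) of `f(w) = ‖Σ_w − I‖_{F,k,k}` yields a good estimate. -/
theorem stmt6 :
    ∃ c₂ > (0:ℝ), ∃ c₃ > (0:ℝ),
      ∀ (n d k : ℕ) (ε δ : ℝ) (μ : Fin d → ℝ) (Xstar X : Fin n → Fin d → ℝ)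
        (G : Finset (Fin n)) (wstar : Fin n → ℝ),
        0 < ε → ε ≤ 1/10 → ε ≤ δ →
        stableMean k ε δ Xstar μ →
        isCorruption ε X Xstar →
        (∀ i ∈ G, X i = Xstar i) →
        (1 - ε) * n ≤ (G.card : ℝ) →
        wstar = uniformOn G →
        ∀ w ∈ Delta n ε,
          (∀ η : ℝ, 0 < η → η < 1 →
            normFkk k (SigmaW X w - 1)
              - (c₃ * Real.sqrt n * δ ^ 2 / Real.sqrt (ε ^ 3)) * η
                  * norm2 (fun i => wstar i - w i)
              ≤ normFkk k (SigmaW X (fun i => (1 - η) * w i + η * wstar i) - 1)) →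
          norm2k k (fun j => muW X w j - μ j) ≤ c₂ * δ := by
  refine ⟨5, by norm_num, 1, one_pos, ?_⟩
  intro n d k ε δ μ Xstar X G wstar hε0 hε hδ hstab _ hXG hG hws w hw hstat
  have hn := one_sub_mul_natCast_pos (by linarith : ε < 1) hw.1
  have hδ0 : 0 < δ := hε0.trans_le hδ
  have hws' : wstar ∈ Delta n ε := hws ▸ uniformOn_mem_Delta hn hG
  have hp : condWeights G w ∈ Delta n (2 * ε) :=
    condWeights_mem_Delta (by linarith) hw hG
  have hwsX : ∀ i, wstar i = 0 ∨ X i = Xstar i := fun i => by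
    by_cases h : i ∈ G
    · exact Or.inr (hXG i h)
    · exact Or.inl (by simp [hws, uniformOn, h])
  have hpX : ∀ i, condWeights G w i = 0 ∨ X i = Xstar i := fun i => by
    by_cases h : i ∈ G
    · exact Or.inr (hXG i h)
    · exact Or.inl (by simp [condWeights, h])
  obtain ⟨hμs, hFs⟩ := hstab wstar (Delta_subset_two_mul hε0.le (by linarith) hws')
  obtain ⟨hμp, hFp⟩ := hstab _ hp
  rw [← muW_congr hwsX] at hμs
  rw [← SigmaW_congr hwsX] at hFs
  rw [← muW_congr hpX] at hμp
  rw [← SigmaW_congr hpX] at hFp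
  set K := δ ^ 2 / ε with hK
  have hεK : ε * K = δ ^ 2 := by rw [hK]; field_simp
  have hεleK : ε ≤ K := by
    rw [hK, le_div_iff₀ hε0]
    nlinarith
  set F := normFkk k (SigmaW X w - 1) with hF
  set r := norm2k k (fun j => muW X w j - muW X wstar j) with hr
  have hFle : F ≤ r ^ 2 + 3 * K := by
    have h1 := hstat (1 / 2) (by norm_num) (by norm_num)
    have h2 := normFkk_segment_le (k := k) X hw.1 hws'.1 (η := 1 / 2) (by norm_num) (by norm_num)
    have h3 := slack_mul_norm2_le (δ := δ) hε0 hε hw hws'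
    rw [one_mul] at h1
    have := sq_nonneg r
    linarith
  set s := norm2k k (fun j => muW X w j - muW X (condWeights G w) j) with hs
  have hs0 : 0 ≤ s := norm2k_nonneg _
  have hrs : r ≤ s + 2 * δ := by
    have h1 := norm2k_sub_le (k := k) (muW X w) (muW X (condWeights G w)) (muW X wstar)
    have h2 := norm2k_sub_le (k := k) (muW X (condWeights G w)) μ (muW X wstar)
    rw [norm2k_sub_comm μ] at h2
    linarith
  have hF0 : 0 ≤ F := normFkk_nonneg _
  have hss : s ^ 2 ≤ ε * (F + 2.2 * K) / 0.64 := by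
    have hB0 : 0 ≤ ε * (F + 2.2 * K) / 0.64 := by positivity
    refine (Real.le_sqrt hs0 hB0).1 (norm2k_le (Real.sqrt_nonneg _) fun S hS => ?_)
    apply Real.sqrt_le_sqrt
    have hε' : 0 < 1 - ε := by linarith
    have hβ := one_sub_sum_le_of_mem_Delta (by linarith) hw hG
    set W := ∑ i ∈ G, w i with hW
    have hWle : (1 - 2 * ε) ≤ (1 - ε) * W := by
      have := mul_le_mul_of_nonneg_left hβ hε'.le
      rw [mul_div_cancel₀ _ hε'.ne'] at this
      linarith
    have hW0 : 0 < W := pos_of_mul_pos_right (by linarith) hε'.le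
    have h := sum_sq_mean_shift_le X G (fun i => (hw.2 i).1) hw.1 hβ hW0 hS
    set q := ∑ a ∈ S, (muW X w a - muW X (condWeights G w) a) ^ 2 with hq
    have hq0 : 0 ≤ q := Finset.sum_nonneg fun i _ => sq_nonneg _
    have hβK : ε / (1 - ε) ≤ 1.2 * K := by
      rw [div_le_iff₀ hε']
      nlinarith
    have h' : (1 - ε) * (W ^ 2 * q) ≤ ε * (F + 2.2 * K) := by
      have h2 : W ^ 2 * q ≤ ε / (1 - ε) * (F + 2.2 * K) :=
        h.trans (mul_le_mul_of_nonneg_left (by linarith) (by positivity))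
      have := mul_le_mul_of_nonneg_left h2 hε'.le
      rwa [← mul_assoc (1 - ε) (ε / (1 - ε)), mul_div_cancel₀ _ hε'.ne'] at this
    have hcoef : 0.64 ≤ (1 - ε) * W ^ 2 := by
      have h3 : 0.8 ≤ (1 - ε) * W := by linarith
      have h4 : 0.8 ≤ W := by nlinarith
      nlinarith
    rw [le_div_iff₀ (by norm_num)]
    nlinarith
  have hs4 : s ≤ 4 * δ := by
    have hr0 : 0 ≤ r := norm2k_nonneg _
    have hr2 : r ^ 2 ≤ 2 * s ^ 2 + 8 * δ ^ 2 := by nlinarith [sq_nonneg (s - 2 * δ)]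
    rw [le_div_iff₀ (by norm_num)] at hss
    have h1 : ε * F ≤ ε * (2 * s ^ 2 + 8 * δ ^ 2 + 3 * K) :=
      mul_le_mul_of_nonneg_left (by linarith) hε0.le
    have h2 : ε * (2 * s ^ 2 + 8 * δ ^ 2) ≤ 1 / 10 * (2 * s ^ 2 + 8 * δ ^ 2) :=
      mul_le_mul_of_nonneg_right hε (by positivity)
    have h3 : s ^ 2 ≤ (4 * δ) ^ 2 := by nlinarith
    exact (pow_le_pow_iff_left₀ hs0 (by positivity) two_ne_zero).1 h3
  have := norm2k_sub_le (k := k) (muW X w) (muW X (condWeights G w)) μ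
  linarith
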